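/- arXiv:2310.05726 — 4 statements merged into one kernel-verified Lean document; each statement's English description precedes it below -/
import Mathlib

section
/- Let n ≥ 1 and d : Fin n → ℕ with d i ≥ 1 for every i, let a, x : ((i : Fin n) → Fin (d i)) → ℂ be vectors, and let J ⊆ Fin n be any finset with complement Jᶜ. Then the Hilbert–Schmidt inner product of the partial traces of the rank-one projectors equals the squared Frobenius norm of the complementary partial trace of a xᴴ; explicitly, ∑_{f,g} conj((tr_J (a aᴴ)) f g) · (tr_J (x xᴴ)) f g = ‖tr_{Jᶜ} (a xᴴ)‖₂². -/
open Finset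

/-- Squared Frobenius (Hilbert–Schmidt) norm of a complex matrix. -/
noncomputable def frobSq {m n : Type*} [Fintype m] [Fintype n] (M : Matrix m n ℂ) : ℝ :=
  ∑ p, ∑ q, ‖M p q‖ ^ 2

/-- Merge an assignment on a finset `J` with an assignment on its complement. -/
def mergeFun {n : ℕ} {d : Fin n → ℕ} (J : Finset (Fin n))
    (h : (i : {i : Fin n // i ∈ J}) → Fin (d i.1))
    (f : (i : {i : Fin n // i ∉ J}) → Fin (d i.1)) :
    (i : Fin n) → Fin (d i) :=
  fun i => if hi : i ∈ J then h ⟨i, hi⟩ else f ⟨i, hi⟩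

/-- Partial trace of a matrix on an `n`-partite system over the subsystems in `J`. -/
noncomputable def ptrace {n : ℕ} {d : Fin n → ℕ} (J : Finset (Fin n))
    (C : Matrix ((i : Fin n) → Fin (d i)) ((i : Fin n) → Fin (d i)) ℂ) :
    Matrix ((i : {i : Fin n // i ∉ J}) → Fin (d i.1))
      ((i : {i : Fin n // i ∉ J}) → Fin (d i.1)) ℂ :=
  Matrix.of fun f g =>
    ∑ h : (i : {i : Fin n // i ∈ J}) → Fin (d i.1), C (mergeFun J h f) (mergeFun J h g)

/-- Reindex families over a subtype along an equivalence of predicates. -/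
def piSubtypeEquivOfIff {ι : Type*} {p q : ι → Prop} (hpq : ∀ i, p i ↔ q i) (β : ι → Type*) :
    ((i : {i : ι // p i}) → β i.1) ≃ ((i : {i : ι // q i}) → β i.1) where
  toFun f i := f ⟨i.1, (hpq i.1).2 i.2⟩
  invFun f i := f ⟨i.1, (hpq i.1).1 i.2⟩
  left_inv _ := rfl
  right_inv _ := rfl

theorem mergeFun_compl {n : ℕ} {d : Fin n → ℕ} (J : Finset (Fin n))
    (h : (i : {i : Fin n // i ∈ J}) → Fin (d i.1))
    (f : (i : {i : Fin n // i ∉ J}) → Fin (d i.1)) :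
    mergeFun Jᶜ
        (piSubtypeEquivOfIff (fun _ => mem_compl.symm) (fun i => Fin (d i)) f)
        (piSubtypeEquivOfIff (fun _ => notMem_compl.symm) (fun i => Fin (d i)) h)
      = mergeFun J h f := by
  funext i
  by_cases hi : i ∈ J <;> simp [mergeFun, piSubtypeEquivOfIff, hi]

theorem ptrace_compl_apply {n : ℕ} {d : Fin n → ℕ} (J : Finset (Fin n))
    (C : Matrix ((i : Fin n) → Fin (d i)) ((i : Fin n) → Fin (d i)) ℂ)
    (h k : (i : {i : Fin n // i ∈ J}) → Fin (d i.1)) :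
    ptrace Jᶜ C
        (piSubtypeEquivOfIff (fun _ => notMem_compl.symm) (fun i => Fin (d i)) h)
        (piSubtypeEquivOfIff (fun _ => notMem_compl.symm) (fun i => Fin (d i)) k)
      = ∑ f, C (mergeFun J h f) (mergeFun J k f) := by
  rw [ptrace, Matrix.of_apply, ← Equiv.sum_comp
    (piSubtypeEquivOfIff (fun _ => mem_compl.symm) (fun i => Fin (d i)))]
  simp only [mergeFun_compl]

theorem frobSq_ptrace_compl {n : ℕ} {d : Fin n → ℕ} (J : Finset (Fin n))
    (C : Matrix ((i : Fin n) → Fin (d i)) ((i : Fin n) → Fin (d i)) ℂ) :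
    frobSq (ptrace Jᶜ C) = ∑ h, ∑ k, ‖∑ f, C (mergeFun J h f) (mergeFun J k f)‖ ^ 2 := by
  rw [frobSq, ← Equiv.sum_comp
    (piSubtypeEquivOfIff (fun _ => notMem_compl.symm) (fun i => Fin (d i)))]
  refine sum_congr rfl fun h _ => ?_
  rw [← Equiv.sum_comp
    (piSubtypeEquivOfIff (fun _ => notMem_compl.symm) (fun i => Fin (d i)))]
  simp only [ptrace_compl_apply]

/-- Exchange of the summation order for a pair of rectangular coefficient arrays. -/
theorem sum_conj_gram_mul_gram {α β : Type*} [Fintype α] [Fintype β] (a x : α → β → ℂ) :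
    (∑ f, ∑ g, (starRingEnd ℂ) (∑ h, a h f * (starRingEnd ℂ) (a h g))
        * ∑ k, x k f * (starRingEnd ℂ) (x k g))
      = ∑ h, ∑ k, ((‖∑ f, a h f * (starRingEnd ℂ) (x k f)‖ : ℝ) : ℂ) ^ 2 := by
  simp only [← Complex.conj_mul', map_sum, map_mul, Complex.conj_conj, sum_mul_sum]
  calc
    _ = ∑ f, ∑ h, ∑ g, ∑ k, (starRingEnd ℂ) (a h f) * a h g * (x k f * (starRingEnd ℂ) (x k g)) :=
      sum_congr rfl fun f _ => sum_comm
    _ = ∑ h, ∑ f, ∑ g, ∑ k, (starRingEnd ℂ) (a h f) * a h g * (x k f * (starRingEnd ℂ) (x k g)) :=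
      sum_comm
    _ = ∑ h, ∑ f, ∑ k, ∑ g, (starRingEnd ℂ) (a h f) * a h g * (x k f * (starRingEnd ℂ) (x k g)) :=
      sum_congr rfl fun h _ => sum_congr rfl fun f _ => sum_comm
    _ = ∑ h, ∑ k, ∑ f, ∑ g, (starRingEnd ℂ) (a h f) * a h g * (x k f * (starRingEnd ℂ) (x k g)) :=
      sum_congr rfl fun h _ => sum_comm
    _ = _ := by
      refine sum_congr rfl fun h _ => sum_congr rfl fun k _ =>
        sum_congr rfl fun f _ => sum_congr rfl fun g _ => ?_
      ring

/-- Hilbert–Schmidt inner product of partial traces of rank-one projectors: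
`⟨tr_J(a aᴴ), tr_J(x xᴴ)⟩ = ‖tr_{Jᶜ}(a xᴴ)‖₂²`. -/
theorem inner_ptrace_eq_frobSq_compl (n : ℕ) (hn : 1 ≤ n) (d : Fin n → ℕ) (hd : ∀ i, 1 ≤ d i)
    (a x : ((i : Fin n) → Fin (d i)) → ℂ) (J : Finset (Fin n)) :
    (∑ f, ∑ g,
        (starRingEnd ℂ)
            (ptrace J (Matrix.of fun p q => a p * (starRingEnd ℂ) (a q)) f g)
          * ptrace J (Matrix.of fun p q => x p * (starRingEnd ℂ) (x q)) f g)
      = (frobSq (ptrace Jᶜ (Matrix.of fun p q => a p * (starRingEnd ℂ) (x q))) : ℂ) := by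
  rw [frobSq_ptrace_compl]
  simp only [ptrace, Matrix.of_apply]
  push_cast
  exact sum_conj_gram_mul_gram (fun h f => a (mergeFun J h f)) fun h f => x (mergeFun J h f)
end

section
/- Let d₁, d₂, d₃ ≥ 1 and let a, x : Fin d₁ × Fin d₂ × Fin d₃ → ℂ. Then ‖a‖²·‖x‖² − ‖tr₁₂ (a xᴴ)‖₂² − ‖tr₁₃ (a xᴴ)‖₂² + ‖tr₂₃ (a xᴴ)‖₂² ≥ 0, where ‖a‖² = ∑_p |a p|² and (a xᴴ) p q = a p · conj(x q). -/
open Finset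

/-- Partial trace over the first factor of a tripartite system. -/
noncomputable def tr1 {d₁ d₂ d₃ : ℕ} (C : Matrix (Fin d₁ × Fin d₂ × Fin d₃) (Fin d₁ × Fin d₂ × Fin d₃) ℂ) :
    Matrix (Fin d₂ × Fin d₃) (Fin d₂ × Fin d₃) ℂ :=
  Matrix.of fun p q => ∑ i, C (i, p.1, p.2) (i, q.1, q.2)

/-- Partial trace over the second factor of a tripartite system. -/
noncomputable def tr2 {d₁ d₂ d₃ : ℕ} (C : Matrix (Fin d₁ × Fin d₂ × Fin d₃) (Fin d₁ × Fin d₂ × Fin d₃) ℂ) :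
    Matrix (Fin d₁ × Fin d₃) (Fin d₁ × Fin d₃) ℂ :=
  Matrix.of fun p q => ∑ j, C (p.1, j, p.2) (q.1, j, q.2)

/-- Partial trace over the third factor of a tripartite system. -/
noncomputable def tr3 {d₁ d₂ d₃ : ℕ} (C : Matrix (Fin d₁ × Fin d₂ × Fin d₃) (Fin d₁ × Fin d₂ × Fin d₃) ℂ) :
    Matrix (Fin d₁ × Fin d₂) (Fin d₁ × Fin d₂) ℂ :=
  Matrix.of fun p q => ∑ k, C (p.1, p.2, k) (q.1, q.2, k)

/-- Partial trace over the first and second factors of a tripartite system. -/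
noncomputable def tr12 {d₁ d₂ d₃ : ℕ} (C : Matrix (Fin d₁ × Fin d₂ × Fin d₃) (Fin d₁ × Fin d₂ × Fin d₃) ℂ) :
    Matrix (Fin d₃) (Fin d₃) ℂ :=
  Matrix.of fun k k' => ∑ i, ∑ j, C (i, j, k) (i, j, k')

/-- Partial trace over the first and third factors of a tripartite system. -/
noncomputable def tr13 {d₁ d₂ d₃ : ℕ} (C : Matrix (Fin d₁ × Fin d₂ × Fin d₃) (Fin d₁ × Fin d₂ × Fin d₃) ℂ) :
    Matrix (Fin d₂) (Fin d₂) ℂ :=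
  Matrix.of fun j j' => ∑ i, ∑ k, C (i, j, k) (i, j', k)

/-- Partial trace over the second and third factors of a tripartite system. -/
noncomputable def tr23 {d₁ d₂ d₃ : ℕ} (C : Matrix (Fin d₁ × Fin d₂ × Fin d₃) (Fin d₁ × Fin d₂ × Fin d₃) ℂ) :
    Matrix (Fin d₁) (Fin d₁) ℂ :=
  Matrix.of fun i i' => ∑ j, ∑ k, C (i, j, k) (i', j, k)

/-- Exchange of the first and second tensor factors between the two copies of a tripartite index. -/
def swap12 {α β γ : Type*} : (α × β × γ) × (α × β × γ) ≃ (α × β × γ) × (α × β × γ) where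
  toFun p := ((p.2.1, p.2.2.1, p.1.2.2), (p.1.1, p.1.2.1, p.2.2.2))
  invFun p := ((p.2.1, p.2.2.1, p.1.2.2), (p.1.1, p.1.2.1, p.2.2.2))
  left_inv _ := rfl
  right_inv _ := rfl

/-- Exchange of the first and third tensor factors between the two copies of a tripartite index. -/
def swap13 {α β γ : Type*} : (α × β × γ) × (α × β × γ) ≃ (α × β × γ) × (α × β × γ) where
  toFun p := ((p.2.1, p.1.2.1, p.2.2.2), (p.1.1, p.2.2.1, p.1.2.2))
  invFun p := ((p.2.1, p.1.2.1, p.2.2.2), (p.1.1, p.2.2.1, p.1.2.2))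
  left_inv _ := rfl
  right_inv _ := rfl

/-- Exchange of the second and third tensor factors between the two copies of a tripartite index. -/
def swap23 {α β γ : Type*} : (α × β × γ) × (α × β × γ) ≃ (α × β × γ) × (α × β × γ) where
  toFun p := ((p.1.1, p.2.2.1, p.2.2.2), (p.2.1, p.1.2.1, p.1.2.2))
  invFun p := ((p.1.1, p.2.2.1, p.2.2.2), (p.2.1, p.1.2.1, p.1.2.2))
  left_inv _ := rfl
  right_inv _ := rfl

/-- The operator `(1 - F₁₂)(1 - F₁₃)` built from the partial swaps is a quarter of its square,
hence positive semidefinite. -/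
theorem four_mul_sum_conj_mul_swap_eq {α β γ : Type*} [Fintype α] [Fintype β] [Fintype γ]
    (v : (α × β × γ) × (α × β × γ) → ℂ) :
    4 * ∑ p, (starRingEnd ℂ) (v p) * (v p - v (swap12 p) - v (swap13 p) + v (swap23 p)) =
      ((∑ p, ‖v p - v (swap12 p) - v (swap13 p) + v (swap23 p)‖ ^ 2 : ℝ) : ℂ) := by
  set w : (α × β × γ) × (α × β × γ) → ℂ :=
    fun p => v p - v (swap12 p) - v (swap13 p) + v (swap23 p) with hw
  have w12 : ∀ p, w (swap12 p) = -w p := by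
    intro p
    simp only [hw, swap12, swap13, swap23, Equiv.coe_fn_mk]
    ring
  have w13 : ∀ p, w (swap13 p) = -w p := by
    intro p
    simp only [hw, swap12, swap13, swap23, Equiv.coe_fn_mk]
    ring
  have w23 : ∀ p, w (swap23 p) = w p := by
    intro p
    simp only [hw, swap12, swap13, swap23, Equiv.coe_fn_mk]
    ring
  have e12 := Equiv.sum_comp swap12 fun p => (starRingEnd ℂ) (v p) * w p
  have e13 := Equiv.sum_comp swap13 fun p => (starRingEnd ℂ) (v p) * w p
  have e23 := Equiv.sum_comp swap23 fun p => (starRingEnd ℂ) (v p) * w p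
  simp only [w12, w13, w23, mul_neg, sum_neg_distrib] at e12 e13 e23
  have key : ∀ p, ((‖w p‖ ^ 2 : ℝ) : ℂ) = (starRingEnd ℂ) (v p) * w p
      - (starRingEnd ℂ) (v (swap12 p)) * w p - (starRingEnd ℂ) (v (swap13 p)) * w p
      + (starRingEnd ℂ) (v (swap23 p)) * w p := by
    intro p
    push_cast
    rw [← Complex.conj_mul']
    simp only [hw, map_add, map_sub]
    ring
  rw [Complex.ofReal_sum]
  change 4 * ∑ p, (starRingEnd ℂ) (v p) * w p = ∑ p, ((‖w p‖ ^ 2 : ℝ) : ℂ)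
  simp only [key, sum_add_distrib, sum_sub_distrib]
  linear_combination -e12 - e13 - e23

/-- The squared Frobenius norm of a partial trace of `a xᴴ` is the expectation of a partial swap
in `a ⊗ x`. -/
theorem ofReal_frobSq_tr12 {d₁ d₂ d₃ : ℕ} (a x : Fin d₁ × Fin d₂ × Fin d₃ → ℂ) :
    ((frobSq (tr12 (Matrix.of fun p q => a p * (starRingEnd ℂ) (x q))) : ℝ) : ℂ) =
      ∑ p, (starRingEnd ℂ) (a p.1 * x p.2) * (a (swap12 p).1 * x (swap12 p).2) := by
  simp only [frobSq, tr12, Matrix.of_apply, Complex.ofReal_sum, Complex.ofReal_pow,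
    ← Complex.mul_conj', map_sum, ← Fintype.sum_prod_type', sum_mul_sum]
  refine Fintype.sum_equiv
    { toFun := fun t => ((t.2.2.1, t.2.2.2, t.1.1), (t.2.1.1, t.2.1.2, t.1.2))
      invFun := fun p => ((p.1.2.2, p.2.2.2), ((p.2.1, p.2.2.1), (p.1.1, p.1.2.1)))
      left_inv := fun _ => rfl
      right_inv := fun _ => rfl } _ _ fun t => ?_
  simp only [swap12, Equiv.coe_fn_mk, map_mul, Complex.conj_conj]
  ring

/-- The squared Frobenius norm of a partial trace of `a xᴴ` is the expectation of a partial swap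
in `a ⊗ x`. -/
theorem ofReal_frobSq_tr13 {d₁ d₂ d₃ : ℕ} (a x : Fin d₁ × Fin d₂ × Fin d₃ → ℂ) :
    ((frobSq (tr13 (Matrix.of fun p q => a p * (starRingEnd ℂ) (x q))) : ℝ) : ℂ) =
      ∑ p, (starRingEnd ℂ) (a p.1 * x p.2) * (a (swap13 p).1 * x (swap13 p).2) := by
  simp only [frobSq, tr13, Matrix.of_apply, Complex.ofReal_sum, Complex.ofReal_pow,
    ← Complex.mul_conj', map_sum, ← Fintype.sum_prod_type', sum_mul_sum]
  refine Fintype.sum_equiv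
    { toFun := fun t => ((t.2.2.1, t.1.1, t.2.2.2), (t.2.1.1, t.1.2, t.2.1.2))
      invFun := fun p => ((p.1.2.1, p.2.2.1), ((p.2.1, p.2.2.2), (p.1.1, p.1.2.2)))
      left_inv := fun _ => rfl
      right_inv := fun _ => rfl } _ _ fun t => ?_
  simp only [swap13, Equiv.coe_fn_mk, map_mul, Complex.conj_conj]
  ring

/-- The squared Frobenius norm of a partial trace of `a xᴴ` is the expectation of a partial swap
in `a ⊗ x`. -/
theorem ofReal_frobSq_tr23 {d₁ d₂ d₃ : ℕ} (a x : Fin d₁ × Fin d₂ × Fin d₃ → ℂ) :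
    ((frobSq (tr23 (Matrix.of fun p q => a p * (starRingEnd ℂ) (x q))) : ℝ) : ℂ) =
      ∑ p, (starRingEnd ℂ) (a p.1 * x p.2) * (a (swap23 p).1 * x (swap23 p).2) := by
  simp only [frobSq, tr23, Matrix.of_apply, Complex.ofReal_sum, Complex.ofReal_pow,
    ← Complex.mul_conj', map_sum, ← Fintype.sum_prod_type', sum_mul_sum]
  refine Fintype.sum_equiv
    { toFun := fun t => ((t.1.1, t.2.2.1, t.2.2.2), (t.1.2, t.2.1.1, t.2.1.2))
      invFun := fun p => ((p.1.1, p.2.1), ((p.2.2.1, p.2.2.2), (p.1.2.1, p.1.2.2)))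
      left_inv := fun _ => rfl
      right_inv := fun _ => rfl } _ _ fun t => ?_
  simp only [swap23, Equiv.coe_fn_mk, map_mul, Complex.conj_conj]
  ring

/-- For any vectors `a`, `x` on a tripartite system,
`‖a‖²‖x‖² − ‖tr₁₂(a xᴴ)‖₂² − ‖tr₁₃(a xᴴ)‖₂² + ‖tr₂₃(a xᴴ)‖₂² ≥ 0`. -/
theorem two_factor_ptrace_ineq (d₁ d₂ d₃ : ℕ) (h₁ : 1 ≤ d₁) (h₂ : 1 ≤ d₂) (h₃ : 1 ≤ d₃)
    (a x : Fin d₁ × Fin d₂ × Fin d₃ → ℂ)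
    (M : Matrix (Fin d₁ × Fin d₂ × Fin d₃) (Fin d₁ × Fin d₂ × Fin d₃) ℂ)
    (hM : M = Matrix.of fun p q => a p * (starRingEnd ℂ) (x q)) :
    0 ≤ (∑ p, ‖a p‖ ^ 2) * (∑ p, ‖x p‖ ^ 2)
        - frobSq (tr12 M) - frobSq (tr13 M) + frobSq (tr23 M) := by
  subst hM
  have h := four_mul_sum_conj_mul_swap_eq fun p => a p.1 * x p.2
  have hnorm : (((∑ p, ‖a p‖ ^ 2) * (∑ p, ‖x p‖ ^ 2) : ℝ) : ℂ) =
      ∑ p : (Fin d₁ × Fin d₂ × Fin d₃) × (Fin d₁ × Fin d₂ × Fin d₃),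
        (starRingEnd ℂ) (a p.1 * x p.2) * (a p.1 * x p.2) := by
    rw [sum_mul_sum, ← Fintype.sum_prod_type', Complex.ofReal_sum]
    refine sum_congr rfl fun p _ => ?_
    rw [Complex.conj_mul', norm_mul]
    push_cast
    ring
  simp only [mul_add, mul_sub, sum_add_distrib, sum_sub_distrib] at h
  rw [← hnorm, ← ofReal_frobSq_tr12, ← ofReal_frobSq_tr13, ← ofReal_frobSq_tr23] at h
  norm_cast at h
  have hpos : (0 : ℝ) ≤ ∑ p : (Fin d₁ × Fin d₂ × Fin d₃) × (Fin d₁ × Fin d₂ × Fin d₃),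
      ‖a p.1 * x p.2 - a (swap12 p).1 * x (swap12 p).2 - a (swap13 p).1 * x (swap13 p).2
        + a (swap23 p).1 * x (swap23 p).2‖ ^ 2 := by positivity
  linarith
end

section
/- Let d₁, d₂ ≥ 1 and let v, w : Fin d₁ × Fin d₂ → ℂ. Then the rank-one matrix C = v wᴴ (i.e. C p q = v p · conj(w q)) satisfies ‖C‖₂² − ‖tr₁ C‖₂² + ‖tr₂ C‖₂² − |tr C|² ≥ 0; equivalently, ‖tr₁ C‖₂² + |tr C|² ≤ ‖v‖²·‖w‖² + ‖tr₂ C‖₂². (This is the positivity of the mixed symmetry form q_{(1,0)}(−1, ·) on rank-one bipartite matrices.) -/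
open Finset

/-- Partial trace over the first tensor factor. -/
noncomputable def ptr1 {d₁ d₂ : ℕ} (C : Matrix (Fin d₁ × Fin d₂) (Fin d₁ × Fin d₂) ℂ) :
    Matrix (Fin d₂) (Fin d₂) ℂ :=
  Matrix.of fun j j' => ∑ i, C (i, j) (i, j')

/-- Partial trace over the second tensor factor. -/
noncomputable def ptr2 {d₁ d₂ : ℕ} (C : Matrix (Fin d₁ × Fin d₂) (Fin d₁ × Fin d₂) ℂ) :
    Matrix (Fin d₁) (Fin d₁) ℂ :=
  Matrix.of fun i i' => ∑ j, C (i, j) (i', j)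

open ComplexConjugate

theorem ofReal_frobSq {m n : Type*} [Fintype m] [Fintype n] (M : Matrix m n ℂ) :
    (frobSq M : ℂ) = ∑ p, ∑ q, M p q * conj (M p q) := by
  simp [frobSq, Complex.mul_conj']

theorem Finset.sum_swap_first_third {α β R : Type*} [Fintype α] [Fintype β] [AddCommMonoid R]
    (f : α → β → α → β → R) :
    ∑ i, ∑ j, ∑ k, ∑ l, f k j i l = ∑ i, ∑ j, ∑ k, ∑ l, f i j k l := by
  rw [sum_comm, sum_comm (f := fun i j => ∑ k, ∑ l, f i j k l)]
  exact sum_congr rfl fun j _ => sum_comm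

theorem Finset.sum_swap_second_fourth {α β R : Type*} [Fintype α] [Fintype β] [AddCommMonoid R]
    (f : α → β → α → β → R) :
    ∑ i, ∑ j, ∑ k, ∑ l, f i l k j = ∑ i, ∑ j, ∑ k, ∑ l, f i j k l := by
  refine sum_congr rfl fun i _ => ?_
  rw [sum_comm, sum_comm (f := fun j k => ∑ l, f i j k l)]
  exact sum_congr rfl fun k _ => sum_comm

section RankOne

variable {d₁ d₂ : ℕ} (v w : Fin d₁ × Fin d₂ → ℂ)

theorem ofReal_frobSq_rankOne :
    (frobSq (Matrix.of fun p q => v p * conj (w q)) : ℂ) =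
      ∑ i, ∑ j, ∑ k, ∑ l, v (i, j) * w (k, l) * conj (v (i, j) * w (k, l)) := by
  simp only [ofReal_frobSq, Matrix.of_apply, Fintype.sum_prod_type, map_mul, Complex.conj_conj]
  refine sum_congr rfl fun i _ => sum_congr rfl fun j _ => sum_congr rfl fun k _ =>
    sum_congr rfl fun l _ => ?_
  ring

theorem ofReal_frobSq_ptr1_rankOne :
    (frobSq (ptr1 (Matrix.of fun p q => v p * conj (w q))) : ℂ) =
      ∑ i, ∑ j, ∑ k, ∑ l, v (i, j) * w (k, l) * conj (v (k, j) * w (i, l)) := by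
  calc
    _ = ∑ j, ∑ i, ∑ l, ∑ k, v (i, j) * w (k, l) * conj (v (k, j) * w (i, l)) := by
        simp only [ofReal_frobSq, ptr1, Matrix.of_apply, map_sum, map_mul, Complex.conj_conj,
          sum_mul_sum]
        refine sum_congr rfl fun j _ => ?_
        rw [sum_comm]
        refine sum_congr rfl fun i _ => sum_congr rfl fun l _ => sum_congr rfl fun k _ => ?_
        ring
    _ = _ := by
        rw [sum_comm]
        exact sum_congr rfl fun i _ => sum_congr rfl fun j _ => sum_comm

theorem ofReal_frobSq_ptr2_rankOne :
    (frobSq (ptr2 (Matrix.of fun p q => v p * conj (w q))) : ℂ) =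
      ∑ i, ∑ j, ∑ k, ∑ l, v (i, j) * w (k, l) * conj (v (i, l) * w (k, j)) := by
  simp only [ofReal_frobSq, ptr2, Matrix.of_apply, map_sum, map_mul, Complex.conj_conj,
    sum_mul_sum]
  refine sum_congr rfl fun i _ => ?_
  rw [sum_comm]
  refine sum_congr rfl fun j _ => sum_congr rfl fun k _ => sum_congr rfl fun l _ => ?_
  ring

theorem ofReal_norm_trace_sq_rankOne :
    ((‖(Matrix.of fun p q => v p * conj (w q)).trace‖ ^ 2 : ℝ) : ℂ) =
      ∑ i, ∑ j, ∑ k, ∑ l, v (i, j) * w (k, l) * conj (v (k, l) * w (i, j)) := by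
  rw [Complex.ofReal_pow, ← Complex.conj_mul']
  simp only [Matrix.trace, Matrix.diag_apply, Matrix.of_apply, map_sum, map_mul,
    Complex.conj_conj, Fintype.sum_prod_type, sum_mul, mul_sum]
  refine sum_congr rfl fun i _ => sum_congr rfl fun j _ => sum_congr rfl fun k _ =>
    sum_congr rfl fun l _ => ?_
  ring

/-- Four times the mixed symmetry form on a rank-one matrix is a sum of squares. -/
theorem four_mul_q10_neg_one_rankOne :
    4 * (frobSq (Matrix.of fun p q => v p * conj (w q))
        - frobSq (ptr1 (Matrix.of fun p q => v p * conj (w q)))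
        + frobSq (ptr2 (Matrix.of fun p q => v p * conj (w q)))
        - ‖(Matrix.of fun p q => v p * conj (w q)).trace‖ ^ 2) =
      ∑ i, ∑ j, ∑ k, ∑ l, ‖v (i, j) * w (k, l) - v (k, l) * w (i, j)
        + v (i, l) * w (k, j) - v (k, j) * w (i, l)‖ ^ 2 := by
  set G : Fin d₁ → Fin d₂ → Fin d₁ → Fin d₂ → ℂ := fun i j k l =>
    v (i, j) * w (k, l) * conj (v (i, j) * w (k, l) - v (k, l) * w (i, j)
        + v (i, l) * w (k, j) - v (k, j) * w (i, l)) with hG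
  apply Complex.ofReal_injective
  have key : ((frobSq (Matrix.of fun p q => v p * conj (w q))
        - frobSq (ptr1 (Matrix.of fun p q => v p * conj (w q)))
        + frobSq (ptr2 (Matrix.of fun p q => v p * conj (w q)))
        - ‖(Matrix.of fun p q => v p * conj (w q)).trace‖ ^ 2 : ℝ) : ℂ) =
      ∑ i, ∑ j, ∑ k, ∑ l, G i j k l := by
    rw [Complex.ofReal_sub, Complex.ofReal_add, Complex.ofReal_sub, ofReal_frobSq_rankOne,
      ofReal_frobSq_ptr1_rankOne, ofReal_frobSq_ptr2_rankOne, ofReal_norm_trace_sq_rankOne]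
    simp only [← sum_sub_distrib, ← sum_add_distrib]
    refine sum_congr rfl fun i _ => sum_congr rfl fun j _ => sum_congr rfl fun k _ =>
      sum_congr rfl fun l _ => ?_
    simp only [hG, map_add, map_sub]
    ring
  have four : 4 * ∑ i, ∑ j, ∑ k, ∑ l, G i j k l =
      ∑ i, ∑ j, ∑ k, ∑ l, (G i j k l + G k j i l + G i l k j + G k l i j) := by
    simp only [sum_add_distrib]
    rw [sum_swap_first_third fun i j k l => G i l k j, sum_swap_first_third G,
      sum_swap_second_fourth G]
    ring
  rw [Complex.ofReal_mul, key, Complex.ofReal_ofNat, four]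
  push_cast
  refine sum_congr rfl fun i _ => sum_congr rfl fun j _ => sum_congr rfl fun k _ =>
    sum_congr rfl fun l _ => ?_
  rw [← Complex.mul_conj']
  simp only [hG, map_add, map_sub]
  ring

end RankOne

/-- Positivity of the mixed symmetry form `q_{(1,0)}(-1, ·)` on rank-one bipartite
matrices: for `C = v wᴴ`, `‖C‖₂² − ‖tr₁C‖₂² + ‖tr₂C‖₂² − |tr C|² ≥ 0`. -/
theorem rank_one_q10_neg_one_nonneg (d₁ d₂ : ℕ) (hd₁ : 1 ≤ d₁) (hd₂ : 1 ≤ d₂)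
    (v w : Fin d₁ × Fin d₂ → ℂ)
    (C : Matrix (Fin d₁ × Fin d₂) (Fin d₁ × Fin d₂) ℂ)
    (hC : C = Matrix.of fun p q => v p * (starRingEnd ℂ) (w q)) :
    0 ≤ frobSq C - frobSq (ptr1 C) + frobSq (ptr2 C) - ‖C.trace‖ ^ 2 := by
  subst hC
  have h := four_mul_q10_neg_one_rankOne v w
  have hs : 0 ≤ ∑ i, ∑ j, ∑ k, ∑ l, ‖v (i, j) * w (k, l) - v (k, l) * w (i, j)
      + v (i, l) * w (k, j) - v (k, j) * w (i, l)‖ ^ 2 := by positivity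
  linarith
end

section
/- Let n be a positive even natural number, d ≥ 2, and ε > 0 a real number. For each i : Fin n let v_i, w_i : Fin d → ℂ be unit vectors with ∑_k conj(v_i k)·(w_i k) = 0. Define V, W : (Fin n → Fin d) → ℂ by V f = ∏_i v_i (f i) and W f = ∏_i w_i (f i), and set C = V Vᴴ − W Wᴴ (a rank-2 matrix). Then q^(n)(−1/2 − ε, C) = ∑_{J ⊆ Fin n} (−1/2 − ε)^{|J|} ‖tr_J C‖₂² < 0. (In particular, the quadratic form q^(n) at parameter α < −1/2 fails to be positive on rank-2 matrices, witnessing the n-distillability of the Werner states ρ_α for α ∈ [−1, −1/2) and n even.) -/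
open Finset

/-- The squared Hilbert–Schmidt distance between the projections onto two unit vectors. -/
theorem frobSq_sub_outer {m : Type*} [Fintype m] (P Q : m → ℂ)
    (hP : ∑ k, ‖P k‖ ^ 2 = 1) (hQ : ∑ k, ‖Q k‖ ^ 2 = 1) :
    frobSq (Matrix.of fun f g =>
      P f * (starRingEnd ℂ) (P g) - Q f * (starRingEnd ℂ) (Q g))
      = 2 - 2 * ‖∑ k, (starRingEnd ℂ) (P k) * Q k‖ ^ 2 := by
  have hP' : ∑ k, P k * (starRingEnd ℂ) (P k) = 1 := by
    simp only [Complex.mul_conj']; exact_mod_cast hP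
  have hQ' : ∑ k, Q k * (starRingEnd ℂ) (Q k) = 1 := by
    simp only [Complex.mul_conj']; exact_mod_cast hQ
  have hs : (starRingEnd ℂ) (∑ k, (starRingEnd ℂ) (P k) * Q k)
      = ∑ k, P k * (starRingEnd ℂ) (Q k) := by simp
  apply Complex.ofReal_injective
  simp only [frobSq, Matrix.of_apply]
  push_cast
  simp only [← Complex.mul_conj']
  rw [hs]
  have expand : ∀ f g : m,
      (P f * (starRingEnd ℂ) (P g) - Q f * (starRingEnd ℂ) (Q g))
        * (starRingEnd ℂ) (P f * (starRingEnd ℂ) (P g) - Q f * (starRingEnd ℂ) (Q g))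
      = (P f * (starRingEnd ℂ) (P f)) * (P g * (starRingEnd ℂ) (P g))
        + (Q f * (starRingEnd ℂ) (Q f)) * (Q g * (starRingEnd ℂ) (Q g))
        - (P f * (starRingEnd ℂ) (Q f)) * ((starRingEnd ℂ) (P g) * Q g)
        - ((starRingEnd ℂ) (P f) * Q f) * (P g * (starRingEnd ℂ) (Q g)) := by
    intro f g
    simp only [map_sub, map_mul, Complex.conj_conj]
    ring
  simp only [expand, sum_sub_distrib, sum_add_distrib, ← mul_sum, ← sum_mul, hP', hQ']
  ring

/-- A product over all sites of a merged assignment splits along `J` and its complement. -/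
theorem prod_mergeFun {n : ℕ} {d : Fin n → ℕ} {R : Type*} [CommMonoid R] (J : Finset (Fin n))
    (u : (i : Fin n) → Fin (d i) → R)
    (h : (i : {i : Fin n // i ∈ J}) → Fin (d i.1))
    (f : (i : {i : Fin n // i ∉ J}) → Fin (d i.1)) :
    ∏ i, u i (mergeFun J h f i) = (∏ i, u i.1 (h i)) * ∏ i, u i.1 (f i) := by
  rw [← Fintype.prod_subtype_mul_prod_subtype (· ∈ J)]
  congr 1
  · refine prod_congr (by ext; simp) fun i _ => ?_
    rw [mergeFun, dif_pos i.2]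
  · exact Fintype.prod_congr _ _ fun i => by rw [mergeFun, dif_neg i.2]

/-- A product of local unit vectors is a unit vector. -/
theorem sum_norm_prod_sq {ι : Type*} [Fintype ι] [DecidableEq ι] {κ : ι → Type*}
    [∀ i, Fintype (κ i)] (u : (i : ι) → κ i → ℂ) (hu : ∀ i, ∑ k, ‖u i k‖ ^ 2 = 1) :
    ∑ f : (i : ι) → κ i, ‖∏ i, u i (f i)‖ ^ 2 = 1 := by
  simp only [norm_prod, ← prod_pow]
  rw [← Fintype.prod_sum (fun i k => ‖u i k‖ ^ 2)]
  simp [hu]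

/-- Tracing out a part of a product of local unit vectors leaves the product over the rest. -/
theorem sum_mergeFun_outer {n : ℕ} {d : Fin n → ℕ} (J : Finset (Fin n))
    (u : (i : Fin n) → Fin (d i) → ℂ) (hu : ∀ i, ∑ k, ‖u i k‖ ^ 2 = 1)
    (f g : (i : {i : Fin n // i ∉ J}) → Fin (d i.1)) :
    ∑ h : (i : {i : Fin n // i ∈ J}) → Fin (d i.1),
      (∏ i, u i (mergeFun J h f i)) * (starRingEnd ℂ) (∏ i, u i (mergeFun J h g i))
      = (∏ i, u i.1 (f i)) * (starRingEnd ℂ) (∏ i, u i.1 (g i)) := by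
  have key : ∑ h : (i : {i : Fin n // i ∈ J}) → Fin (d i.1),
      (∏ i, u i.1 (h i)) * (starRingEnd ℂ) (∏ i, u i.1 (h i)) = 1 := by
    simp only [Complex.mul_conj']
    exact_mod_cast sum_norm_prod_sq (fun i : {i : Fin n // i ∈ J} => u i.1) fun i => hu i.1
  simp only [prod_mergeFun, map_mul]
  rw [← one_mul ((∏ i, u i.1 (f i)) * _), ← key, sum_mul]
  simp only [map_prod]
  exact sum_congr rfl fun h _ => by ring

/-- The partial traces of the difference of two product projections with orthogonal factors. -/
theorem frobSq_ptrace_sub_outer {n : ℕ} {d : Fin n → ℕ} (J : Finset (Fin n))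
    (v w : (i : Fin n) → Fin (d i) → ℂ)
    (hv : ∀ i, ∑ k, ‖v i k‖ ^ 2 = 1) (hw : ∀ i, ∑ k, ‖w i k‖ ^ 2 = 1)
    (hvw : ∀ i, ∑ k, (starRingEnd ℂ) (v i k) * w i k = 0) :
    frobSq (ptrace J (Matrix.of fun f g =>
      (∏ i, v i (f i)) * (starRingEnd ℂ) (∏ i, v i (g i))
        - (∏ i, w i (f i)) * (starRingEnd ℂ) (∏ i, w i (g i))))
      = if J = univ then 0 else 2 := by
  simp only [ptrace, Matrix.of_apply, sum_sub_distrib, sum_mergeFun_outer J v hv,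
    sum_mergeFun_outer J w hw]
  rw [frobSq_sub_outer _ _
    (sum_norm_prod_sq (fun i : {i : Fin n // i ∉ J} => v i.1) fun i => hv i.1)
    (sum_norm_prod_sq (fun i : {i : Fin n // i ∉ J} => w i.1) fun i => hw i.1)]
  simp only [map_prod, ← prod_mul_distrib]
  rw [← Fintype.prod_sum (fun (i : {i : Fin n // i ∉ J}) k =>
    (starRingEnd ℂ) (v i.1 k) * w i.1 k)]
  simp only [hvw]
  split_ifs with hJ
  · subst hJ
    simp
  · obtain ⟨i, hi⟩ : ∃ i, i ∉ J := by simpa [eq_univ_iff_forall] using hJ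
    rw [prod_eq_zero (mem_univ (⟨i, hi⟩ : {i : Fin n // i ∉ J})) rfl]
    simp

/-- For `n` even, the rank-2 matrix `C = V Vᴴ − W Wᴴ` built from pairwise orthonormal local
unit vectors makes `q^(n)(−1/2 − ε, C)` negative for every `ε > 0`. -/
theorem qn_neg_below_neg_half (n : ℕ) (hn : 0 < n) (hne : Even n) (d : ℕ) (hd : 2 ≤ d)
    (ε : ℝ) (hε : 0 < ε)
    (v w : Fin n → Fin d → ℂ)
    (hv : ∀ i, ∑ k, ‖v i k‖ ^ 2 = 1) (hw : ∀ i, ∑ k, ‖w i k‖ ^ 2 = 1)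
    (hvw : ∀ i, ∑ k, (starRingEnd ℂ) (v i k) * w i k = 0)
    (C : Matrix (Fin n → Fin d) (Fin n → Fin d) ℂ)
    (hC : C = Matrix.of fun f g =>
      (∏ i, v i (f i)) * (starRingEnd ℂ) (∏ i, v i (g i))
        - (∏ i, w i (f i)) * (starRingEnd ℂ) (∏ i, w i (g i))) :
    ∑ J : Finset (Fin n), (-(1 / 2) - ε) ^ J.card
        * frobSq (ptrace (d := fun _ => d) J C) < 0 := by
  subst hC
  simp only [frobSq_ptrace_sub_outer _ v w hv hw hvw]
  have hsum : ∑ J : Finset (Fin n), (-(1 / 2) - ε) ^ J.card = (1 / 2 - ε) ^ n := by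
    have := Fintype.sum_pow_mul_eq_add_pow (Fin n) (-(1 / 2) - ε) 1
    simp only [one_pow, mul_one, Fintype.card_fin] at this
    rw [this]
    ring
  have hlt : (1 / 2 - ε) ^ n < (-(1 / 2) - ε) ^ n := by
    rw [← hne.pow_abs (1 / 2 - ε), ← hne.pow_abs (-(1 / 2) - ε)]
    refine pow_lt_pow_left₀ ?_ (abs_nonneg _) hn.ne'
    rw [abs_of_neg (a := -(1 / 2) - ε) (by linarith), abs_lt]
    constructor <;> linarith
  have hterm : ∀ J : Finset (Fin n),
      (-(1 / 2) - ε) ^ J.card * (if J = univ then (0 : ℝ) else 2)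
        = 2 * (-(1 / 2) - ε) ^ J.card - if J = univ then 2 * (-(1 / 2) - ε) ^ n else 0 := by
    intro J
    split_ifs with hJ
    · simp [hJ]
    · ring
  simp only [hterm, sum_sub_distrib, ← mul_sum, hsum, sum_ite_eq', mem_univ, if_true]
  linarith
end
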